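/- arXiv:2510.22186 — 6 statements merged into one kernel-verified Lean document; each statement's English description precedes it below -/
import Mathlib

section
/- Let n, D be natural numbers and d > 1 a natural number, and let A ∈ ℝ^{d×D} be a full spark matrix. If D ≥ n(d−1)+1, then the sorting-based embedding β_A separates S_n-orbits: for all X, Y ∈ ℝ^{n×d}, β_A(X) = β_A(Y) implies that X = σY for some permutation σ ∈ S_n. -/
open Matrix MeasureTheory

/-- `sortVec v` rearranges the entries of `v` in non-decreasing order. -/
noncomputable def sortVec {n : ℕ} (v : Fin n → ℝ) : Fin n → ℝ := v ∘ Tuple.sort v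

/-- The sorting-based embedding `β_A`: the `k`-th column of `β_A X` is `sort (X a_k)`,
where `a_k` is the `k`-th column of `A`. -/
noncomputable def betaEmb {n d D : ℕ} (A : Matrix (Fin d) (Fin D) ℝ)
    (X : Matrix (Fin n) (Fin d) ℝ) : Matrix (Fin n) (Fin D) ℝ :=
  Matrix.of fun i k => sortVec (X.mulVec fun l => A l k) i

/-- Frobenius norm of a real matrix. -/
noncomputable def frob {n m : ℕ} (M : Matrix (Fin n) (Fin m) ℝ) : ℝ :=
  Real.sqrt (∑ i, ∑ j, (M i j) ^ 2)

/-- `dist(X,Y) = min_{σ ∈ S_n} ‖X - σY‖_F`, where `σ` acts by permuting rows. -/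
noncomputable def permDist {n d : ℕ} (X Y : Matrix (Fin n) (Fin d) ℝ) : ℝ :=
  ⨅ σ : Equiv.Perm (Fin n), frob (X - Y.submatrix σ id)

/-- A wide matrix has full spark if every `d` of its columns are linearly independent. -/
def FullSpark {d D : ℕ} (A : Matrix (Fin d) (Fin D) ℝ) : Prop :=
  ∀ f : Fin d → Fin D, Function.Injective f →
    LinearIndependent ℝ (fun i : Fin d => fun l : Fin d => A l (f i))

/-- A vector orthogonal to at least `d` columns of a full spark matrix vanishes. -/
theorem FullSpark.eq_zero_of_dotProduct {d D : ℕ} {A : Matrix (Fin d) (Fin D) ℝ}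
    (hA : FullSpark A) (s : Finset (Fin D)) (hs : d ≤ s.card) (v : Fin d → ℝ)
    (hv : ∀ k ∈ s, v ⬝ᵥ (fun l => A l k) = 0) : v = 0 := by
  let f : Fin d → Fin D := fun i => s.orderEmbOfFin rfl (Fin.castLE hs i)
  have hf : Function.Injective f :=
    (s.orderEmbOfFin rfl).injective.comp (Fin.castLE_injective hs)
  have hdet : IsUnit (Matrix.of fun i : Fin d => fun l : Fin d => A l (f i)) :=
    Matrix.linearIndependent_rows_iff_isUnit.mp (hA f hf)
  apply Matrix.mulVec_injective_of_isUnit hdet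
  ext i
  have := hv (f i) (Finset.orderEmbOfFin_mem s rfl _)
  rw [dotProduct_comm] at this
  simpa [Matrix.mulVec] using this

/-- Multisets of at most `(D - 1) / (d - 1)` vectors are determined by their projections
onto the columns of a full spark matrix. -/
theorem FullSpark.multiset_eq {d D : ℕ} (hd : 1 < d) {A : Matrix (Fin d) (Fin D) ℝ}
    (hA : FullSpark A) (S T : Multiset (Fin d → ℝ))
    (hD : S.card * (d - 1) + 1 ≤ D)
    (h : ∀ k, S.map (fun v => v ⬝ᵥ fun l => A l k) = T.map (fun v => v ⬝ᵥ fun l => A l k)) :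
    S = T := by
  classical
  have hcard : S.card = T.card := by
    simpa using congrArg Multiset.card (h ⟨0, by omega⟩)
  induction S using Multiset.induction_on generalizing T with
  | empty => exact (Multiset.card_eq_zero.mp (by simpa using hcard.symm)).symm
  | cons x S ih =>
    have hex : ∀ k, ∃ y ∈ T, (y ⬝ᵥ fun l => A l k) = x ⬝ᵥ fun l => A l k := fun k => by
      rw [← Multiset.mem_map, ← h k]
      simp
    choose g hg hgx using hex
    obtain ⟨y, hy, hlt⟩ := Finset.exists_lt_card_fiber_of_mul_lt_card_of_maps_to
      (s := (Finset.univ : Finset (Fin D))) (t := T.toFinset) (f := g) (n := d - 1)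
      (fun k _ => Multiset.mem_toFinset.mpr (hg k)) (by
        have := Nat.mul_le_mul_right (d - 1) (hcard ▸ T.toFinset_card_le)
        rw [Finset.card_univ, Fintype.card_fin]
        omega)
    have hxy : y = x := by
      refine sub_eq_zero.mp <| hA.eq_zero_of_dotProduct {k | g k = y} (by omega) _ fun k hk => ?_
      rw [sub_dotProduct, ← hgx k, (Finset.mem_filter.mp hk).2, sub_self]
    subst hxy
    obtain ⟨T, rfl⟩ := Multiset.exists_cons_of_mem (Multiset.mem_toFinset.mp hy)
    rw [ih T _ (fun k => by simpa using h k) (by simpa using hcard)]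
    refine le_trans ?_ hD
    gcongr
    exact Multiset.le_cons_self S y

/-- Families with the same sorted rearrangement have the same multiset of values. -/
theorem map_univ_eq_of_sortVec_eq {n : ℕ} {v w : Fin n → ℝ} (h : sortVec v = sortVec w) :
    Finset.univ.val.map v = Finset.univ.val.map w := by
  have key : ∀ u : Fin n → ℝ, Finset.univ.val.map (sortVec u) = Finset.univ.val.map u :=
    fun u => by
    rw [sortVec, ← Multiset.map_map, Multiset.map_univ_val_equiv]
  rw [← key v, ← key w, h]

/-- Two families with the same multiset of values differ by a permutation of the indices. -/
theorem exists_perm_of_map_univ_eq {ι α : Type*} [Fintype ι] {f g : ι → α}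
    (h : Finset.univ.val.map f = Finset.univ.val.map g) :
    ∃ σ : Equiv.Perm ι, ∀ i, f i = g (σ i) := by
  classical
  have e : ∀ c, Nonempty ({i // f i = c} ≃ {i // g i = c}) := fun c => by
    rw [← Fintype.card_eq, Fintype.card_subtype, Fintype.card_subtype]
    simpa [Multiset.count_map, Finset.card_def, eq_comm] using congrArg (Multiset.count c) h
  exact ⟨Equiv.ofFiberEquiv fun c => (e c).some, fun i => (Equiv.ofFiberEquiv_map _ i).symm⟩

/-- If `D ≥ n(d-1)+1` and `A` has full spark, then `β_A` separates `S_n`-orbits. -/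
theorem stmt0 (n D d : ℕ) (hd : 1 < d) (A : Matrix (Fin d) (Fin D) ℝ)
    (hA : FullSpark A) (hD : D ≥ n * (d - 1) + 1)
    (X Y : Matrix (Fin n) (Fin d) ℝ) (h : betaEmb A X = betaEmb A Y) :
    ∃ σ : Equiv.Perm (Fin n), X = Y.submatrix σ id := by
  have hXY : Finset.univ.val.map (fun i => X i) = Finset.univ.val.map (fun i => Y i) := by
    refine hA.multiset_eq hd _ _ (by simpa using hD) fun k => ?_
    rw [Multiset.map_map, Multiset.map_map]
    exact map_univ_eq_of_sortVec_eq (funext fun i => congrFun (congrFun h i) k)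
  obtain ⟨σ, hσ⟩ := exists_perm_of_map_univ_eq hXY
  exact ⟨σ, funext hσ⟩
end

section
/- Let d, n, D be natural numbers with D ≥ (2n−1)d. Then the set of pairs (A, B) ∈ ℝ^{d×D} × ℝ^{n×D} for which δ_{A,B} fails to separate S_n-orbits (i.e., for which there exist X, Y ∈ ℝ^{n×d} with δ_{A,B}(X) = δ_{A,B}(Y) but X ≠ σY for every σ ∈ S_n) has Lebesgue measure zero in ℝ^{d×D} × ℝ^{n×D} ≃ ℝ^{(n+d)D}. -/
open Matrix MeasureTheory

/-- The projected sorting embedding `δ_{A,B}(X)_k = b_kᵀ sort(X a_k)`. -/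
noncomputable def deltaEmb {n d D : ℕ} (A : Matrix (Fin d) (Fin D) ℝ)
    (B : Matrix (Fin n) (Fin D) ℝ) (X : Matrix (Fin n) (Fin d) ℝ) : Fin D → ℝ :=
  fun k => ∑ i, B i k * sortVec (X.mulVec fun l => A l k) i

/-- The rows of a real matrix are independent iff its Gram determinant does not vanish. -/
lemma linearIndependent_iff_det_mul_transpose_ne_zero {m ι : Type*} [Fintype m] [DecidableEq m]
    [Fintype ι] (R : Matrix m ι ℝ) :
    LinearIndependent ℝ (fun k => R k) ↔ (R * Rᵀ).det ≠ 0 := by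
  have h1 := Matrix.vecMul_injective_iff (M := R)
  have h2 := Matrix.exists_vecMul_eq_zero_iff (M := R * Rᵀ)
  have h3 : ∀ v : m → ℝ, v ᵥ* (R * Rᵀ) = 0 ↔ v ᵥ* R = 0 := fun v => by
    simpa using Matrix.vecMul_self_mul_conjTranspose_eq_zero R v
  change LinearIndependent ℝ R.row ↔ _
  rw [← h1, ← not_iff_not, not_not, ← h2]
  simp only [h3]
  change ¬ Function.Injective (R.vecMulLinear) ↔ _
  rw [injective_iff_map_eq_zero]
  push Not
  simp [and_comm]

/-- If the rows of a matrix depend quadratically on a parameter, as entrywise products of two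
linear functionals, and are independent for one value of it, then they are for almost every one. -/
lemma ae_linearIndependent_mul {E m ι : Type*} [NormedAddCommGroup E] [NormedSpace ℝ E]
    [FiniteDimensional ℝ E] [MeasurableSpace E] [BorelSpace E] (μ : Measure E)
    [μ.IsAddHaarMeasure] [Finite m] [Finite ι] (f g : m → ι → E →ₗ[ℝ] ℝ) (v : E)
    (hv : LinearIndependent ℝ fun k c => f k c v * g k c v) :
    ∀ᵐ p ∂μ, LinearIndependent ℝ fun k c => f k c p * g k c p := by
  classical
  cases nonempty_fintype m
  cases nonempty_fintype ι
  let R : E → Matrix m ι ℝ := fun p => Matrix.of fun k c => f k c p * g k c p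
  have hR : ∀ p, LinearIndependent ℝ (fun k c => f k c p * g k c p) ↔
      (R p * (R p)ᵀ).det ≠ 0 := fun p =>
    linearIndependent_iff_det_mul_transpose_ne_zero (R p)
  have hRc : Continuous R := by
    refine continuous_matrix fun k c => ?_
    exact ((f k c).continuous_of_finiteDimensional).mul ((g k c).continuous_of_finiteDimensional)
  have hdet : Continuous fun p => (R p * (R p)ᵀ).det :=
    (hRc.matrix_mul hRc.matrix_transpose).matrix_det
  have hopen : IsOpen {p | (R p * (R p)ᵀ).det ≠ 0} := isOpen_ne_fun hdet continuous_const
  simp only [hR]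
  refine ae_mem_of_ae_add_linearMap_mem (LinearMap.toSpanSingleton ℝ E v) volume μ
    hopen.measurableSet fun y => ?_
  let M : Matrix m ι (Polynomial ℝ) := Matrix.of fun k c =>
    (Polynomial.C (f k c y) + Polynomial.X * Polynomial.C (f k c v)) *
      (Polynomial.C (g k c y) + Polynomial.X * Polynomial.C (g k c v))
  have hM : ∀ t : ℝ, (M * Mᵀ).det.eval t = (R (y + t • v) * (R (y + t • v))ᵀ).det := fun t => by
    rw [← Polynomial.coe_evalRingHom, RingHom.map_det, RingHom.mapMatrix_apply, Matrix.map_mul,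
      Matrix.transpose_map]
    have : M.map (Polynomial.evalRingHom t) = R (y + t • v) := by
      ext k c
      simp [M, R, mul_comm t]
    rw [this]
  have hM0 : (M * Mᵀ).det ≠ 0 := by
    have hnear : ∀ᶠ s : ℝ in nhds 0, (R (s • y + v) * (R (s • y + v))ᵀ).det ≠ 0 := by
      have hc : Continuous fun s : ℝ => s • y + v := by fun_prop
      refine hc.continuousAt.eventually (hopen.mem_nhds ?_)
      simpa using (hR v).1 hv
    obtain ⟨s, hs, hs0⟩ :=
      ((hnear.filter_mono nhdsWithin_le_nhds).and (self_mem_nhdsWithin (s := {0}ᶜ))).exists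
    have hs0 : s ≠ 0 := hs0
    intro h
    apply (hR (s • y + v)).2 hs |>.units_smul (fun _ => (Units.mk0 s⁻¹ (inv_ne_zero hs0)) ^ 2)
      |> (hR (y + s⁻¹ • v)).1 ∘ fun hi => ?_
    · rw [← hM, h, Polynomial.eval_zero]
    · convert hi using 1
      ext k c
      simp [Units.smul_def]
      field_simp
  have hfin : {t : ℝ | (M * Mᵀ).det.IsRoot t}.Finite := Polynomial.finite_setOfPred_isRoot hM0
  filter_upwards [hfin.countable.ae_notMem volume] with t ht
  change ¬ (M * Mᵀ).det.eval t = 0 at ht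
  rwa [hM] at ht

/-- The kernel of a matrix with independent rows has codimension the number of rows. -/
lemma finrank_ker_mulVecLin_of_linearIndependent {m ι : Type*} [Fintype m] [Fintype ι]
    (R : Matrix m ι ℝ) (h : LinearIndependent ℝ fun k => R k) :
    Fintype.card m + Module.finrank ℝ (LinearMap.ker R.mulVecLin) = Fintype.card ι := by
  have := R.mulVecLin.finrank_range_add_finrank_ker
  have h2 : R.rank = Fintype.card m := LinearIndependent.rank_matrix h
  rw [Matrix.rank] at h2
  rw [← h2, this, Module.finrank_fintype_fun_eq_card]

/-- For fixed permutations `σ`, `τ`, the linear functional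
`(X, Y) ↦ ∑ i, b i * ((X a) (σ i) - (Y a) (τ i))` of a pair of matrices, as a vector. -/
def pairRow {n d : ℕ} (σ τ : Equiv.Perm (Fin n)) (a : Fin d → ℝ) (b : Fin n → ℝ) :
    (Fin n × Fin d) ⊕ (Fin n × Fin d) → ℝ :=
  Sum.elim (fun c => b (σ.symm c.1) * a c.2) (fun c => -b (τ.symm c.1) * a c.2)

/-- A pair of matrices as a single vector. -/
def pairVec {n d : ℕ} (X Y : Matrix (Fin n) (Fin d) ℝ) :
    (Fin n × Fin d) ⊕ (Fin n × Fin d) → ℝ :=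
  Sum.elim (fun c => X c.1 c.2) (fun c => Y c.1 c.2)

lemma pairRow_dotProduct_pairVec {n d : ℕ} (σ τ : Equiv.Perm (Fin n)) (a : Fin d → ℝ)
    (b : Fin n → ℝ) (X Y : Matrix (Fin n) (Fin d) ℝ) :
    pairRow σ τ a b ⬝ᵥ pairVec X Y =
      ∑ i, b i * X.mulVec a (σ i) - ∑ i, b i * Y.mulVec a (τ i) := by
  rw [← Equiv.sum_comp σ.symm fun i => b i * X.mulVec a (σ i),
    ← Equiv.sum_comp τ.symm fun i => b i * Y.mulVec a (τ i)]
  simp only [pairRow, pairVec, dotProduct, mulVec, Fintype.sum_sum_type, Sum.elim_inl,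
    Sum.elim_inr, Fintype.sum_prod_type, Equiv.apply_symm_apply, Finset.mul_sum, sub_eq_add_neg,
    ← Finset.sum_neg_distrib]
  congr 1 <;> refine Finset.sum_congr rfl fun i _ => Finset.sum_congr rfl fun l _ => ?_ <;> ring

lemma exists_perm_of_forall_pairRow {n d : ℕ} (σ τ : Equiv.Perm (Fin n))
    (X Y : Matrix (Fin n) (Fin d) ℝ) (h : ∀ a b, pairRow σ τ a b ⬝ᵥ pairVec X Y = 0) :
    ∃ ρ : Equiv.Perm (Fin n), X = Y.submatrix ρ id := by
  refine ⟨σ.symm.trans τ, ?_⟩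
  ext i l
  have := h (Pi.single l 1) (Pi.single (σ.symm i) 1)
  rw [pairRow_dotProduct_pairVec] at this
  simpa [Pi.single_apply, sub_eq_zero] using this

/-- If the `D ≥ (2n-1)d` rows are independent, their common kernel is the space of pairs `(X, X)` with
constant columns. -/
lemma eq_of_linearIndependent_pairRow {n d D : ℕ} (hD : (2 * n - 1) * d ≤ D)
    (σ τ : Fin D → Equiv.Perm (Fin n)) (a : Fin D → Fin d → ℝ) (b : Fin D → Fin n → ℝ)
    (hli : LinearIndependent ℝ fun k => pairRow (σ k) (τ k) (a k) (b k))
    (X Y : Matrix (Fin n) (Fin d) ℝ)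
    (h : ∀ k, pairRow (σ k) (τ k) (a k) (b k) ⬝ᵥ pairVec X Y = 0) : X = Y := by
  rcases n.eq_zero_or_pos with rfl | hn
  · exact Subsingleton.elim _ _
  let R : Matrix (Fin D) ((Fin n × Fin d) ⊕ (Fin n × Fin d)) ℝ :=
    Matrix.of fun k => pairRow (σ k) (τ k) (a k) (b k)
  let L : (Fin d → ℝ) →ₗ[ℝ] ((Fin n × Fin d) ⊕ (Fin n × Fin d) → ℝ) :=
    { toFun := fun w => pairVec (Matrix.of fun _ => w) (Matrix.of fun _ => w)
      map_add' := fun w w' => by ext (c | c) <;> simp [pairVec]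
      map_smul' := fun t w => by ext (c | c) <;> simp [pairVec] }
  have hL : Function.Injective L := fun w w' hw => by
    ext l
    simpa [L, pairVec] using congrFun hw (Sum.inl (⟨0, hn⟩, l))
  have hle : LinearMap.range L ≤ LinearMap.ker R.mulVecLin := by
    rintro _ ⟨w, rfl⟩
    ext k
    change pairRow _ _ _ _ ⬝ᵥ pairVec _ _ = 0
    rw [pairRow_dotProduct_pairVec, sub_eq_zero]
    rfl
  have hker := finrank_ker_mulVecLin_of_linearIndependent R hli
  have hrange := LinearMap.finrank_range_of_inj hL
  simp only [Module.finrank_fintype_fun_eq_card, Fintype.card_fin, Fintype.card_sum,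
    Fintype.card_prod] at hker hrange
  have hdim : Module.finrank ℝ (LinearMap.ker R.mulVecLin) ≤ d := by
    obtain ⟨n, rfl⟩ : ∃ n', n = n' + 1 := ⟨n - 1, by omega⟩
    have : 2 * (n + 1) - 1 = 2 * n + 1 := by omega
    rw [this] at hD
    nlinarith
  have heq := Submodule.eq_of_le_of_finrank_le hle (by omega)
  have hmem : pairVec X Y ∈ LinearMap.ker R.mulVecLin := by
    ext k
    exact h k
  rw [← heq] at hmem
  obtain ⟨w, hw⟩ := hmem
  ext i l
  have h1 := congrFun hw (Sum.inl (i, l))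
  have h2 := congrFun hw (Sum.inr (i, l))
  simp only [L, pairVec, LinearMap.coe_mk, AddHom.coe_mk, Sum.elim_inl, Sum.elim_inr,
    Matrix.of_apply] at h1 h2
  rw [← h1, h2]

/-- The row attached to index `k` by the parameter `p = (A, B)`. -/
def paramRow {n d D : ℕ} (σ τ : Fin D → Equiv.Perm (Fin n))
    (p : (Fin d → Fin D → ℝ) × (Fin n → Fin D → ℝ)) (k : Fin D) :
    (Fin n × Fin d) ⊕ (Fin n × Fin d) → ℝ :=
  pairRow (σ k) (τ k) (fun l => p.1 l k) (fun i => p.2 i k)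

lemma ae_linearIndepOn_paramRow {n d D : ℕ} (σ τ : Fin D → Equiv.Perm (Fin n)) (s : Set (Fin D))
    (μ : Measure ((Fin d → Fin D → ℝ) × (Fin n → Fin D → ℝ))) [μ.IsAddHaarMeasure]
    (p₀ : (Fin d → Fin D → ℝ) × (Fin n → Fin D → ℝ))
    (h : LinearIndepOn ℝ (paramRow σ τ p₀) s) :
    ∀ᵐ p ∂μ, LinearIndepOn ℝ (paramRow σ τ p) s := by
  let E := (Fin d → Fin D → ℝ) × (Fin n → Fin D → ℝ)
  let α : Fin d → Fin D → E →ₗ[ℝ] ℝ := fun l k =>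
    LinearMap.proj k ∘ₗ LinearMap.proj l ∘ₗ LinearMap.fst ℝ _ _
  let β : Fin n → Fin D → E →ₗ[ℝ] ℝ := fun i k =>
    LinearMap.proj k ∘ₗ LinearMap.proj i ∘ₗ LinearMap.snd ℝ _ _
  have key := ae_linearIndependent_mul (m := s) (ι := (Fin n × Fin d) ⊕ (Fin n × Fin d)) μ
    (fun k => Sum.elim (fun c => β ((σ k).symm c.1) k) (fun c => -β ((τ k).symm c.1) k))
    (fun k => Sum.elim (fun c => α c.2 k) (fun c => α c.2 k)) p₀
  have hrow : ∀ p : E, (fun (k : s) c =>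
      (Sum.elim (fun c => β ((σ k).symm c.1) k) (fun c => -β ((τ k).symm c.1) k) :
        (Fin n × Fin d) ⊕ (Fin n × Fin d) → E →ₗ[ℝ] ℝ) c p *
      (Sum.elim (fun c => α c.2 k) (fun c => α c.2 k) :
        (Fin n × Fin d) ⊕ (Fin n × Fin d) → E →ₗ[ℝ] ℝ) c p) =
      fun k : s => paramRow σ τ p k := by
    intro p
    ext k (c | c)
    · rfl
    · rfl
  simp only [hrow] at key
  exact key h

/-- For fixed sorting permutations, almost every parameter only identifies matrices in the same
orbit. -/
lemma ae_exists_perm_of_forall_paramRow {n d D : ℕ} (hD : (2 * n - 1) * d ≤ D)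
    (σ τ : Fin D → Equiv.Perm (Fin n))
    (μ : Measure ((Fin d → Fin D → ℝ) × (Fin n → Fin D → ℝ))) [μ.IsAddHaarMeasure] :
    ∀ᵐ p ∂μ, ∀ X Y : Matrix (Fin n) (Fin d) ℝ,
      (∀ k, paramRow σ τ p k ⬝ᵥ pairVec X Y = 0) →
        ∃ ρ : Equiv.Perm (Fin n), X = Y.submatrix ρ id := by
  by_cases hall : ∃ p₀, LinearIndepOn ℝ (paramRow (d := d) σ τ p₀) Set.univ
  · obtain ⟨p₀, hp₀⟩ := hall
    filter_upwards [ae_linearIndepOn_paramRow σ τ Set.univ μ p₀ hp₀] with p hp X Y hXY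
    exact ⟨1, eq_of_linearIndependent_pairRow hD σ τ _ _ (linearIndepOn_univ_iff.1 hp) X Y hXY⟩
  obtain ⟨s, hs⟩ : ∃ s, Maximal (fun s : Set (Fin D) =>
      ∃ p₀, LinearIndepOn ℝ (paramRow (d := d) σ τ p₀) s) s :=
    (Set.toFinite _).exists_maximal ⟨∅, 0, linearIndepOn_empty ℝ _⟩
  obtain ⟨p₀, hp₀⟩ := hs.prop
  obtain ⟨m, hm⟩ : ∃ m, m ∉ s := by
    by_contra! hcon
    exact hall ⟨p₀, by rwa [← Set.eq_univ_of_forall hcon]⟩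
  filter_upwards [ae_linearIndepOn_paramRow σ τ s μ p₀ hp₀] with p hp X Y hXY
  refine exists_perm_of_forall_pairRow (σ m) (τ m) X Y fun a b => ?_
  let q : (Fin d → Fin D → ℝ) × (Fin n → Fin D → ℝ) :=
    (fun l => Function.update (p.1 l) m (a l), fun i => Function.update (p.2 i) m (b i))
  have hqm : paramRow σ τ q m = pairRow (σ m) (τ m) a b := by simp [paramRow, q]
  have hqs : Set.EqOn (paramRow σ τ q) (paramRow σ τ p) s := fun k hk => by
    have : k ≠ m := fun h => hm (h ▸ hk)
    simp [paramRow, q, this]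
  have hspan : paramRow σ τ q m ∈ Submodule.span ℝ (paramRow σ τ q '' s) := by
    by_contra hcon
    have hins := (linearIndepOn_insert hm).2 ⟨hp.congr hqs.symm, hcon⟩
    exact hm (hs.le_of_ge ⟨q, hins⟩ (Set.subset_insert m s) (Set.mem_insert m s))
  rw [hqm, hqs.image_eq] at hspan
  generalize pairRow (σ m) (τ m) a b = z at hspan
  induction hspan using Submodule.span_induction with
  | mem x hx =>
    obtain ⟨k, -, rfl⟩ := hx
    exact hXY k
  | zero => exact zero_dotProduct _
  | add x y _ _ hx hy => rw [add_dotProduct, hx, hy, add_zero]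
  | smul t x _ hx => rw [smul_dotProduct, hx, smul_zero]

/-- If `D ≥ (2n-1)d`, the set of pairs `(A,B)` for which `δ_{A,B}` fails to separate
`S_n`-orbits has Lebesgue measure zero. -/
theorem stmt2 (n d D : ℕ) (hD : D ≥ (2 * n - 1) * d) :
    ((Measure.pi fun _ : Fin d => Measure.pi fun _ : Fin D => (volume : Measure ℝ)).prod
      (Measure.pi fun _ : Fin n => Measure.pi fun _ : Fin D => (volume : Measure ℝ)))
      {p : (Fin d → Fin D → ℝ) × (Fin n → Fin D → ℝ) |
        ∃ X Y : Matrix (Fin n) (Fin d) ℝ,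
          deltaEmb (Matrix.of p.1) (Matrix.of p.2) X = deltaEmb (Matrix.of p.1) (Matrix.of p.2) Y ∧
          ∀ σ : Equiv.Perm (Fin n), X ≠ Y.submatrix σ id} = 0 := by
  change (volume : Measure ((Fin d → Fin D → ℝ) × (Fin n → Fin D → ℝ))) _ = 0
  have : (volume : Measure ((Fin d → Fin D → ℝ) × (Fin n → Fin D → ℝ))).IsAddHaarMeasure :=
    have h (e : ℕ) : (volume : Measure (Fin e → Fin D → ℝ)).IsAddHaarMeasure :=
      Measure.pi.isAddHaarMeasure _
    have := h d
    have := h n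
    Measure.prod.instIsAddHaarMeasure _ _
  have hae := ae_all_iff.2 fun στ : (Fin D → Equiv.Perm (Fin n)) × (Fin D → Equiv.Perm (Fin n)) =>
    ae_exists_perm_of_forall_paramRow (d := d) hD στ.1 στ.2 volume
  refine measure_mono_null ?_ hae
  rintro p ⟨X, Y, hXY, hne⟩ hp
  obtain ⟨ρ, hρ⟩ := hp (fun k => Tuple.sort (X.mulVec fun l => p.1 l k),
    fun k => Tuple.sort (Y.mulVec fun l => p.1 l k)) X Y fun k => by
      rw [paramRow, pairRow_dotProduct_pairVec, sub_eq_zero]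
      exact congrFun hXY k
  exact hne ρ hρ
end

section
/- Let d, r, n, D be natural numbers (r ≥ 1) and let A ∈ ℝ^{d×D}. If D ≥ r·d·((n−1)²+1), then for all X, Y ∈ ℝ^{n×d}, ‖β_A(X) − β_A(Y)‖_F ≥ (min over index sets I ⊆ [D] with |I| = r·d of σ_d(A(I))) · dist(X,Y), where A(I) denotes the d × |I| submatrix of A consisting of the columns indexed by I. -/
open Matrix MeasureTheory

/-- `singularValue M k` is the `k`-th largest singular value of `M` (1-based), i.e. the
square root of the `k`-th largest eigenvalue of `M * Mᴴ`; it is `0` when `k - 1 ≥ d`. -/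
noncomputable def singularValue {d D : ℕ} (M : Matrix (Fin d) (Fin D) ℝ) (k : ℕ) : ℝ :=
  if h : k - 1 < d then
    Real.sqrt (-(sortVec
      (fun i => -((Matrix.isHermitian_mul_conjTranspose_self M).eigenvalues i)) ⟨k - 1, h⟩))
  else 0

/-- The Rayleigh quotient of a real symmetric matrix is bounded below by any lower bound of
its eigenvalues. -/
theorem le_dotProduct_mulVec_of_le_eigenvalues {d : ℕ} {B : Matrix (Fin d) (Fin d) ℝ}
    (hB : B.IsHermitian) {c : ℝ} (hc : ∀ i, c ≤ hB.eigenvalues i) (v : Fin d → ℝ) :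
    c * (v ⬝ᵥ v) ≤ v ⬝ᵥ (B *ᵥ v) := by
  set b := hB.eigenvectorBasis
  have hinner (x y : Fin d → ℝ) :
      x ⬝ᵥ y = ∑ i, (x ⬝ᵥ (b i).ofLp) * ((b i).ofLp ⬝ᵥ y) := by
    have h := b.sum_inner_mul_inner (WithLp.toLp 2 x) (WithLp.toLp 2 y)
    simp only [EuclideanSpace.inner_eq_star_dotProduct, star_trivial] at h
    rw [dotProduct_comm x y, ← h]
    exact Finset.sum_congr rfl fun i _ => by
      rw [dotProduct_comm x, dotProduct_comm _ y]
  have heig (i : Fin d) :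
      (b i).ofLp ⬝ᵥ (B *ᵥ v) = hB.eigenvalues i * ((b i).ofLp ⬝ᵥ v) := by
    have hT : Bᵀ = B := by simpa [IsHermitian, conjTranspose_eq_transpose_of_trivial] using hB
    rw [dotProduct_mulVec, ← mulVec_transpose, hT, hB.mulVec_eigenvectorBasis i,
      smul_dotProduct, smul_eq_mul]
  rw [hinner v v, hinner v (B *ᵥ v), Finset.mul_sum]
  refine Finset.sum_le_sum fun i _ => ?_
  rw [heig, dotProduct_comm v]
  nlinarith [mul_le_mul_of_nonneg_right (hc i) (mul_self_nonneg ((b i).ofLp ⬝ᵥ v))]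

theorem le_sortVec_last {d : ℕ} (v : Fin d → ℝ) (h : d - 1 < d) (i : Fin d) :
    v i ≤ sortVec v ⟨d - 1, h⟩ := by
  have hm := Tuple.monotone_sort v
    (show (Tuple.sort v).symm i ≤ ⟨d - 1, h⟩ from Nat.le_sub_one_of_lt (Fin.isLt _))
  simpa [sortVec] using hm

theorem singularValue_nonneg {d m : ℕ} (M : Matrix (Fin d) (Fin m) ℝ) (k : ℕ) :
    0 ≤ singularValue M k := by
  unfold singularValue
  split_ifs
  · exact Real.sqrt_nonneg _
  · exact le_rfl

/-- The `d`-th singular value of a matrix with `d` rows bounds `‖Mᵀ v‖ / ‖v‖` from below. -/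
theorem singularValue_sq_mul_le {d m : ℕ} (M : Matrix (Fin d) (Fin m) ℝ) (v : Fin d → ℝ) :
    singularValue M d ^ 2 * ∑ l, v l ^ 2 ≤ ∑ j, (∑ l, v l * M l j) ^ 2 := by
  rcases Nat.eq_zero_or_pos d with rfl | hd
  · simp
  have h : d - 1 < d := by omega
  set hB := isHermitian_mul_conjTranspose_self M
  have hle (i : Fin d) : singularValue M d ^ 2 ≤ hB.eigenvalues i := by
    have hlast := le_sortVec_last (fun i => -hB.eigenvalues i) h i
    have hnonneg : 0 ≤ hB.eigenvalues i :=
      (posSemidef_self_mul_conjTranspose M).eigenvalues_nonneg i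
    have hmin : -sortVec (fun i => -hB.eigenvalues i) ⟨d - 1, h⟩ ≤ hB.eigenvalues i := by
      linarith
    rw [singularValue, dif_pos h, ← Real.sq_sqrt hnonneg]
    exact pow_le_pow_left₀ (Real.sqrt_nonneg _) (Real.sqrt_le_sqrt hmin) 2
  have hray := le_dotProduct_mulVec_of_le_eigenvalues hB hle v
  rw [conjTranspose_eq_transpose_of_trivial, ← mulVec_mulVec, dotProduct_mulVec,
    mulVec_transpose] at hray
  simpa [dotProduct, vecMul, sq] using hray

/-- A family of permutations indexed by a large enough set contains, for some permutation `σ`,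
at least `q` members agreeing with `σ` at `i`, for each `i`. -/
theorem exists_perm_le_card_agree {n q D : ℕ} (hq : 1 ≤ q) (hD : q * ((n - 1) ^ 2 + 1) ≤ D)
    (P : Fin D → Equiv.Perm (Fin n)) :
    ∃ σ : Equiv.Perm (Fin n), ∀ i, q ≤ (Finset.univ.filter fun k => P k i = σ i).card := by
  classical
  set N : Fin n → Fin n → ℕ := fun i j => (Finset.univ.filter fun k => P k i = j).card
  have hrow (i : Fin n) : ∑ j, N i j = D := by
    have h := Finset.card_eq_sum_card_fiberwise (s := (Finset.univ : Finset (Fin D)))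
      (t := Finset.univ) (f := fun k => P k i) (fun _ _ => by simp)
    simpa [N] using h.symm
  have hcol (j : Fin n) : ∑ i, N i j = D := by
    have h := Finset.card_eq_sum_card_fiberwise (s := (Finset.univ : Finset (Fin D)))
      (t := Finset.univ) (f := fun k => (P k).symm j) (fun _ _ => by simp)
    simpa [N, Equiv.symm_apply_eq, eq_comm (a := j)] using h.symm
  have hall : ∀ S : Finset (Fin n),
      S.card ≤ (S.biUnion fun i => Finset.univ.filter fun j => q ≤ N i j).card := by
    intro S
    set T := S.biUnion fun i => Finset.univ.filter fun j => q ≤ N i j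
    by_contra! hlt
    have hsmall : ∑ i ∈ S, ∑ j ∈ Tᶜ, N i j ≤ S.card * (Tᶜ.card * (q - 1)) := by
      refine Finset.sum_le_card_nsmul _ _ _ fun i hi => Finset.sum_le_card_nsmul _ _ _ fun j hj => ?_
      have : ¬ q ≤ N i j := fun h =>
        Finset.mem_compl.mp hj (Finset.mem_biUnion.mpr ⟨i, hi, by simpa using h⟩)
      omega
    have hT : ∑ i ∈ S, ∑ j ∈ T, N i j ≤ T.card * D := by
      rw [Finset.sum_comm]
      refine Finset.sum_le_card_nsmul _ _ _ fun j _ => ?_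
      rw [← hcol j]
      exact Finset.sum_le_sum_of_subset (Finset.subset_univ S)
    have hS : ∑ i ∈ S, ∑ j ∈ T, N i j + ∑ i ∈ S, ∑ j ∈ Tᶜ, N i j = S.card * D := by
      rw [← Finset.sum_add_distrib]
      simp [Finset.sum_add_sum_compl, hrow]
    have hSn : S.card ≤ n := by simpa using S.card_le_univ
    rw [Finset.card_compl, Fintype.card_fin] at hsmall
    obtain ⟨p, hp⟩ : ∃ p, S.card = T.card + p + 1 := ⟨S.card - T.card - 1, by omega⟩
    obtain ⟨w, hw⟩ : ∃ w, n = S.card + w := ⟨n - S.card, by omega⟩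
    obtain ⟨z, rfl⟩ : ∃ z, q = z + 1 := ⟨q - 1, by omega⟩
    generalize S.card = s at *
    generalize T.card = t at *
    subst hp hw
    rw [show t + p + 1 + w - t = p + 1 + w by omega, Nat.add_sub_cancel] at hsmall
    rw [show t + p + 1 + w - 1 = t + p + w by omega] at hD
    have hexcess : (p + 1) * D ≤ (t + p + 1) * ((p + 1 + w) * z) := by nlinarith
    have hcount : (t + p + 1) * (p + 1 + w) ≤ (p + 1) * ((t + p + w) ^ 2 + 1) := by
      have hsq (a : ℕ) : a ≤ a ^ 2 := Nat.le_self_pow two_ne_zero a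
      have hw' : (t + p) + w + (t + p) * w ≤ (t + p + w) ^ 2 := by
        nlinarith [hsq (t + p), hsq w, Nat.zero_le ((t + p) * w)]
      nlinarith [Nat.mul_le_mul_left (p + 1) hw', Nat.zero_le (p * ((t + p) * w)),
        Nat.zero_le (p * w)]
    have hD' := Nat.mul_le_mul_left (p + 1) hD
    have hz := Nat.mul_le_mul_right z hcount
    nlinarith [Nat.zero_le ((p + 1) * (t + p + w) ^ 2)]
  obtain ⟨f, hinj, hf⟩ :=
    (Finset.all_card_le_biUnion_card_iff_exists_injective _).mp hall
  exact ⟨Equiv.ofBijective f (Finite.injective_iff_bijective.mp hinj),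
    fun i => by simpa [N] using hf i⟩

theorem sum_sortVec_sub_sq {n : ℕ} (u v : Fin n → ℝ) :
    ∑ i, (sortVec u i - sortVec v i) ^ 2 =
      ∑ i, (u i - v (((Tuple.sort u).symm.trans (Tuple.sort v)) i)) ^ 2 := by
  conv_rhs => rw [← Equiv.sum_comp (Tuple.sort u)]
  simp [sortVec]

theorem frob_sq {n m : ℕ} (M : Matrix (Fin n) (Fin m) ℝ) :
    frob M ^ 2 = ∑ i, ∑ j, M i j ^ 2 :=
  Real.sq_sqrt (Finset.sum_nonneg fun _ _ => Finset.sum_nonneg fun _ _ => sq_nonneg _)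

theorem frob_nonneg {n m : ℕ} (M : Matrix (Fin n) (Fin m) ℝ) : 0 ≤ frob M :=
  Real.sqrt_nonneg _

theorem permDist_nonneg {n d : ℕ} (X Y : Matrix (Fin n) (Fin d) ℝ) : 0 ≤ permDist X Y :=
  Real.iInf_nonneg fun _ => frob_nonneg _

theorem permDist_le {n d : ℕ} (X Y : Matrix (Fin n) (Fin d) ℝ) (σ : Equiv.Perm (Fin n)) :
    permDist X Y ≤ frob (X - Y.submatrix σ id) :=
  ciInf_le ⟨0, by rintro _ ⟨τ, rfl⟩; exact frob_nonneg _⟩ σ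

/-- The minimum of `d`-th singular values over `q`-column submatrices controls every partial
frame energy over at least `q` columns. -/
theorem iInf_singularValue_sq_mul_le {d D q : ℕ} (A : Matrix (Fin d) (Fin D) ℝ)
    (K : Finset (Fin D)) (hK : q ≤ K.card) (v : Fin d → ℝ) :
    (⨅ f : {f : Fin q → Fin D // Function.Injective f},
        singularValue (Matrix.of fun (i : Fin d) (j : Fin q) => A i (f.1 j)) d) ^ 2 *
      ∑ l, v l ^ 2 ≤ ∑ k ∈ K, (∑ l, v l * A l k) ^ 2 := by
  obtain ⟨I, hIK, hI⟩ := Finset.exists_subset_card_eq hK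
  set g := I.orderEmbOfFin hI
  have hinf := ciInf_le (f := fun f : {f : Fin q → Fin D // Function.Injective f} =>
      singularValue (Matrix.of fun (i : Fin d) (j : Fin q) => A i (f.1 j)) d)
    ⟨0, by rintro _ ⟨f, rfl⟩; exact singularValue_nonneg _ _⟩ ⟨g, g.injective⟩
  calc
    _ ≤ singularValue (Matrix.of fun (i : Fin d) (j : Fin q) => A i (g j)) d ^ 2 *
          ∑ l, v l ^ 2 :=
      mul_le_mul_of_nonneg_right
        (pow_le_pow_left₀ (Real.iInf_nonneg fun _ => singularValue_nonneg _ _) hinf 2)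
        (Finset.sum_nonneg fun _ _ => sq_nonneg _)
    _ ≤ ∑ j, (∑ l, v l * A l (g j)) ^ 2 := singularValue_sq_mul_le _ v
    _ = ∑ k ∈ I, (∑ l, v l * A l k) ^ 2 := by
      rw [← Finset.map_orderEmbOfFin_univ I hI, Finset.sum_map]
      rfl
    _ ≤ _ := Finset.sum_le_sum_of_subset_of_nonneg hIK fun _ _ _ => sq_nonneg _

/-- If `D ≥ r·d·((n-1)²+1)`, the lower Lipschitz constant of `β_A` is at least the minimum,
over index sets `I ⊆ [D]` of cardinality `r·d`, of the `d`-th singular value of the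
submatrix `A(I)` of the corresponding columns of `A`. -/
theorem stmt4 (d r n D : ℕ) (hr : 1 ≤ r) (A : Matrix (Fin d) (Fin D) ℝ)
    (hD : D ≥ r * d * ((n - 1) ^ 2 + 1)) (X Y : Matrix (Fin n) (Fin d) ℝ) :
    frob (betaEmb A X - betaEmb A Y) ≥
      (⨅ f : {f : Fin (r * d) → Fin D // Function.Injective f},
        singularValue (Matrix.of fun (i : Fin d) (j : Fin (r * d)) => A i (f.1 j)) d) *
        permDist X Y := by
  rcases Nat.eq_zero_or_pos d with rfl | hd
  · have h : permDist X Y = 0 :=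
      le_antisymm ((permDist_le X Y 1).trans (by simp [frob])) (permDist_nonneg X Y)
    rw [h, mul_zero]
    exact frob_nonneg _
  set c := ⨅ f : {f : Fin (r * d) → Fin D // Function.Injective f},
    singularValue (Matrix.of fun (i : Fin d) (j : Fin (r * d)) => A i (f.1 j)) d with hc
  set P : Fin D → Equiv.Perm (Fin n) := fun k =>
    (Tuple.sort (X *ᵥ fun l => A l k)).symm.trans (Tuple.sort (Y *ᵥ fun l => A l k)) with hP
  obtain ⟨σ, hσ⟩ := exists_perm_le_card_agree (Nat.mul_pos hr hd) hD P
  have hbeta : frob (betaEmb A X - betaEmb A Y) ^ 2 =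
      ∑ i, ∑ k, (∑ l, (X i l - Y (P k i) l) * A l k) ^ 2 := by
    rw [frob_sq, Finset.sum_comm]
    conv_rhs => rw [Finset.sum_comm]
    refine Finset.sum_congr rfl fun k _ => ?_
    refine (sum_sortVec_sub_sq (X *ᵥ fun l => A l k) (Y *ᵥ fun l => A l k)).trans ?_
    simp only [mulVec, dotProduct, sub_mul, Finset.sum_sub_distrib, hP]
  have hrow (i : Fin n) : c ^ 2 * ∑ l, (X i l - Y (σ i) l) ^ 2 ≤
      ∑ k, (∑ l, (X i l - Y (P k i) l) * A l k) ^ 2 := by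
    refine (iInf_singularValue_sq_mul_le A _ (hσ i) fun l => X i l - Y (σ i) l).trans ?_
    refine le_trans (Finset.sum_le_sum fun k hk => ?_) (Finset.sum_le_sum_of_subset_of_nonneg
      (Finset.filter_subset _ _) fun _ _ _ => sq_nonneg _)
    rw [(Finset.mem_filter.mp hk).2]
  have hc0 : 0 ≤ c := Real.iInf_nonneg fun _ => singularValue_nonneg _ _
  refine (mul_le_mul_of_nonneg_left (permDist_le X Y σ) hc0).trans
    (le_of_sq_le_sq ?_ (frob_nonneg _))
  rw [mul_pow, hbeta, frob_sq, Finset.mul_sum]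
  exact Finset.sum_le_sum fun i _ => hrow i
end

section
/- Let n ≥ 1 be a natural number and let S ∈ ℝ^{n×n} be a doubly stochastic matrix (all entries nonnegative, every row sum and every column sum equal to 1). Then there exists a permutation σ ∈ S_n such that S_{i,σ(i)} ≥ 1/((n−1)²+1) for every i ∈ [n]. -/
/-- The size of an `a × (n - b)` block with `b < a ≤ n` is at most `(a - b) ((n - 1)² + 1)`. -/
theorem mul_sub_le_sub_mul_sq_add_one {n a b : ℕ} (hba : b < a) (han : a ≤ n) :
    (a : ℝ) * ((n : ℝ) - b) ≤ ((a : ℝ) - b) * (((n : ℝ) - 1) ^ 2 + 1) := by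
  obtain ⟨p, rfl⟩ := Nat.exists_eq_add_of_lt hba
  obtain ⟨q, rfl⟩ := Nat.exists_eq_add_of_le han
  have key : (b + p + 1) * (q + p + 1) ≤ (p + 1) * ((b + p + q) ^ 2 + 1) := by
    have hp := Nat.le_self_pow two_ne_zero (b + p)
    have hq := Nat.le_self_pow two_ne_zero q
    have h : (b + p + 1) * (q + 1) ≤ (b + p + q) ^ 2 + 1 := by nlinarith
    calc (b + p + 1) * (q + p + 1) ≤ (p + 1) * ((b + p + 1) * (q + 1)) := by
          have : q + p + 1 ≤ (p + 1) * (q + 1) := by nlinarith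
          nlinarith
      _ ≤ _ := Nat.mul_le_mul_left _ h
  have key' : ((b : ℝ) + p + 1) * (q + p + 1) ≤ (p + 1) * ((b + p + q) ^ 2 + 1) := by
    exact_mod_cast key
  push_cast
  linarith

/-- Every doubly stochastic `n × n` matrix has a permutation `σ` with
`S_{i,σ(i)} ≥ 1/((n-1)²+1)` for every `i`. -/
theorem stmt6 (n : ℕ) (hn : 1 ≤ n) (S : Matrix (Fin n) (Fin n) ℝ)
    (hpos : ∀ i j, 0 ≤ S i j) (hrow : ∀ i, ∑ j, S i j = 1) (hcol : ∀ j, ∑ i, S i j = 1) :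
    ∃ σ : Equiv.Perm (Fin n), ∀ i, S i (σ i) ≥ 1 / (((n : ℝ) - 1) ^ 2 + 1) := by
  classical
  set ε : ℝ := 1 / (((n : ℝ) - 1) ^ 2 + 1) with hε
  suffices h : ∃ f : Fin n → Fin n, Function.Injective f ∧ ∀ i, ε ≤ S i (f i) by
    obtain ⟨f, hf, hfS⟩ := h
    exact ⟨Equiv.ofBijective f (Finite.injective_iff_bijective.mp hf), hfS⟩
  refine (Fintype.all_card_le_filter_rel_iff_exists_injective fun i j => ε ≤ S i j).mp ?_
  intro A
  by_contra! hlt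
  set B : Finset (Fin n) := {j | ∃ i ∈ A, ε ≤ S i j} with hB
  replace hlt : B.card < A.card := lt_of_eq_of_lt (by rw [hB]; congr!) hlt
  have hAn : A.card ≤ n := by simpa using A.card_le_univ
  have hsmall : ∀ i ∈ A, ∀ j ∈ Bᶜ, S i j < ε := by
    intro i hi j hj
    by_contra! hle
    exact Finset.mem_compl.mp hj (by simpa [hB] using ⟨i, hi, hle⟩)
  have hA : A.Nonempty := Finset.card_pos.mp (by omega)
  have hBc : Bᶜ.Nonempty := Finset.card_pos.mp (by
    rw [Finset.card_compl, Fintype.card_fin]; omega)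
  have hcard : ((Bᶜ.card : ℕ) : ℝ) = n - B.card := by
    rw [Finset.card_compl, Fintype.card_fin, Nat.cast_sub (by omega)]
  have hsplit : (A.card : ℝ) = ∑ i ∈ A, ∑ j ∈ B, S i j + ∑ i ∈ A, ∑ j ∈ Bᶜ, S i j := by
    simp [← Finset.sum_add_distrib, Finset.sum_add_sum_compl, hrow]
  have hblock : ∑ i ∈ A, ∑ j ∈ B, S i j ≤ B.card := by
    calc ∑ i ∈ A, ∑ j ∈ B, S i j = ∑ j ∈ B, ∑ i ∈ A, S i j := Finset.sum_comm
      _ ≤ ∑ j ∈ B, ∑ i, S i j :=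
          Finset.sum_le_sum fun j _ =>
            Finset.sum_le_sum_of_subset_of_nonneg A.subset_univ fun i _ _ => hpos i j
      _ = B.card := by simp [hcol]
  have hrest : ∑ i ∈ A, ∑ j ∈ Bᶜ, S i j < A.card * (n - B.card) * ε := by
    calc ∑ i ∈ A, ∑ j ∈ Bᶜ, S i j < ∑ i ∈ A, ∑ j ∈ Bᶜ, ε :=
          Finset.sum_lt_sum_of_nonempty hA fun i hi =>
            Finset.sum_lt_sum_of_nonempty hBc (hsmall i hi)
      _ = A.card * (n - B.card) * ε := by
          simp only [Finset.sum_const, nsmul_eq_mul, hcard, mul_assoc]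
  have hbound : (A.card : ℝ) * (n - B.card) * ε ≤ A.card - B.card := by
    rw [hε, mul_one_div, div_le_iff₀ (by positivity)]
    exact mul_sub_le_sub_mul_sq_add_one hlt hAn
  linarith
end

section
/- Let D ≥ 3 be a natural number and let a_k := (cos(2πk/D), sin(2πk/D)) ∈ ℝ² for k ∈ [D]. Then for every unit vector x ∈ S¹ ⊂ ℝ², there are at most 2 indices k ∈ [D] with |a_kᵀ x| < 2/D; i.e., the matrix A ∈ ℝ^{2×D} with columns a_1,…,a_D has (3, 2/D)-projective uniformity. -/
/-- The `k`-th (1-based) of `D` equispaced unit vectors on the circle: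
`a_k = (cos(2πk/D), sin(2πk/D))`. -/
noncomputable def circCol (D : ℕ) (k : Fin D) : Fin 2 → ℝ :=
  ![Real.cos (2 * Real.pi * ((k : ℕ) + 1) / D), Real.sin (2 * Real.pi * ((k : ℕ) + 1) / D)]

theorem exists_int_abs_sub_lt_of_abs_cos_lt {t ε : ℝ} (h : |Real.cos t| < 2 * ε) :
    ∃ n : ℤ, |t - Real.pi / 2 - n * Real.pi| < Real.pi * ε := by
  have hpi := Real.pi_pos
  set n : ℤ := round ((t - Real.pi / 2) / Real.pi)
  set s : ℝ := t - Real.pi / 2 - n * Real.pi with hs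
  have hsle : |s| ≤ Real.pi / 2 := by
    have hround : |(t - Real.pi / 2) / Real.pi - n| ≤ 1 / 2 := abs_sub_round _
    have hmul : s = ((t - Real.pi / 2) / Real.pi - n) * Real.pi := by
      rw [hs]; field_simp
    rw [hmul, abs_mul, abs_of_pos hpi]
    nlinarith
  have hcos : |Real.cos t| = |Real.sin s| := by
    have ht : t = (s + n * Real.pi) + Real.pi / 2 := by rw [hs]; ring
    rw [ht, Real.cos_add_pi_div_two, Real.sin_add_int_mul_pi, abs_neg, abs_mul]
    simp
  have hsin := Real.mul_abs_le_abs_sin hsle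
  refine ⟨n, ?_⟩
  have hlt : 2 / Real.pi * |s| < 2 * ε := by linarith
  have hscale : |s| = Real.pi / 2 * (2 / Real.pi * |s|) := by field_simp
  rw [← hs, hscale]
  nlinarith

theorem exists_eq_cos_sin_of_sum_sq_eq_one {x : Fin 2 → ℝ} (hx : ∑ i, x i ^ 2 = 1) :
    ∃ φ : ℝ, x 0 = Real.cos φ ∧ x 1 = Real.sin φ := by
  rw [Fin.sum_univ_two] at hx
  have hnorm : ‖(⟨x 0, x 1⟩ : ℂ)‖ = 1 := by
    rw [Complex.norm_def, Complex.normSq_mk, ← sq, ← sq, hx, Real.sqrt_one]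
  refine ⟨Complex.arg ⟨x 0, x 1⟩, ?_, ?_⟩
  · simpa [hnorm] using (Complex.norm_mul_cos_arg ⟨x 0, x 1⟩).symm
  · simpa [hnorm] using (Complex.norm_mul_sin_arg ⟨x 0, x 1⟩).symm

/-- For `D ≥ 3` and any unit vector `x ∈ S¹`, at most `2` of the equispaced unit vectors
`a_k` satisfy `|a_kᵀ x| < 2/D`: the matrix with columns `a_1,…,a_D` has
`(3, 2/D)`-projective uniformity. -/
theorem stmt7 (D : ℕ) (hD : 3 ≤ D) (x : Fin 2 → ℝ) (hx : ∑ i, x i ^ 2 = 1) :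
    Set.ncard {k : Fin D | |∑ i, circCol D k i * x i| < 2 / (D : ℝ)} ≤ 2 := by
  obtain ⟨φ, h0, h1⟩ := exists_eq_cos_sin_of_sum_sq_eq_one hx
  have hD0 : (0 : ℝ) < D := by exact_mod_cast (by omega : 0 < D)
  have hpi := Real.pi_pos
  set c : ℝ := (φ + Real.pi / 2) * D / Real.pi with hc
  have key : ∀ k : Fin D, |∑ i, circCol D k i * x i| < 2 / (D : ℝ) →
      ∃ n : ℤ, |2 * ((k : ℕ) + 1) - c - n * D| < 1 := by
    intro k hk
    have hdot : ∑ i, circCol D k i * x i =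
        Real.cos (2 * Real.pi * ((k : ℕ) + 1) / D - φ) := by
      rw [Fin.sum_univ_two, h0, h1, Real.cos_sub]
      simp [circCol]
    rw [hdot, div_eq_mul_inv 2 (D : ℝ)] at hk
    obtain ⟨n, hn⟩ := exists_int_abs_sub_lt_of_abs_cos_lt hk
    refine ⟨n, ?_⟩
    have hscale : 2 * ((k : ℕ) + 1) - c - n * D =
        (2 * Real.pi * ((k : ℕ) + 1) / D - φ - Real.pi / 2 - n * Real.pi) *
          (D / Real.pi) := by
      rw [hc]; field_simp; ring
    rw [hscale, abs_mul, abs_of_pos (div_pos hD0 hpi)]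
    calc _ < Real.pi * (D : ℝ)⁻¹ * (D / Real.pi) := by gcongr
      _ = 1 := by field_simp
  choose! n hn using key
  have hinj : Set.InjOn (fun k => decide (Even (n k)))
      {k : Fin D | |∑ i, circCol D k i * x i| < 2 / (D : ℝ)} := by
    intro k hk l hl hkl
    have hpar : Even (n k - n l) := by
      rw [Int.even_sub]; simpa using hkl
    obtain ⟨j, hj⟩ := hpar
    have hjr : (n k : ℝ) - n l = j + j := by exact_mod_cast hj
    have hnk := abs_lt.1 (hn k hk)
    have hnl := abs_lt.1 (hn l hl)
    have hmul : (n k : ℝ) * D - n l * D = 2 * (j * D) := by rw [← sub_mul, hjr]; ring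
    have hlow : (-1 : ℝ) < (k : ℕ) - (l : ℕ) - j * D := by linarith
    have hupp : ((k : ℕ) : ℝ) - (l : ℕ) - j * D < 1 := by linarith
    have hlow' : (-1 : ℤ) < (k : ℕ) - (l : ℕ) - j * D := by exact_mod_cast hlow
    have hupp' : ((k : ℕ) : ℤ) - (l : ℕ) - j * D < 1 := by exact_mod_cast hupp
    have hdvd : (D : ℤ) ∣ (k : ℕ) - (l : ℕ) := ⟨j, by linarith [mul_comm (D : ℤ) j]⟩
    have hzero := Int.eq_zero_of_abs_lt_dvd hdvd (by rw [abs_lt]; omega)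
    exact Fin.ext (by omega)
  calc _ ≤ (Set.univ : Set Bool).ncard :=
        Set.ncard_le_ncard_of_injOn _ (fun _ _ => Set.mem_univ _) hinj
    _ = 2 := by simp
end

section
/- There exists an absolute constant C > 0 with the following property. Let d, D be natural numbers, let λ ∈ {1/D, 2/D, …, 1} (i.e., λD is an integer in [D]), and suppose D ≥ C·d/λ². Let A ∈ ℝ^{d×D} be a random matrix whose entries are independent standard normal random variables, with columns a_1,…,a_D. Then with probability at least 1 − exp(−(2/9)·λ²·D), for every unit vector x ∈ S^{d−1} the number of indices k ∈ [D] with |a_kᵀ x| < (√π/(3√2))·λ is at most λD − 1; i.e., A has (λD, (√π/(3√2))·λ)-projective uniformity. -/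
open MeasureTheory

open ProbabilityTheory Metric

open scoped ENNReal

/-- A volume argument: `ε`-separated families in the unit ball have cardinality at most
`(1 + 2 / ε) ^ dim`. -/
theorem card_le_of_separated_unit_ball {E : Type*} [NormedAddCommGroup E] [NormedSpace ℝ E]
    [FiniteDimensional ℝ E] {ε : ℝ} (hε : 0 < ε) (s : Finset E) (hs : ∀ c ∈ s, ‖c‖ ≤ 1)
    (h : ∀ c ∈ s, ∀ c' ∈ s, c ≠ c' → ε ≤ ‖c - c'‖) :
    (s.card : ℝ) ≤ (1 + 2 / ε) ^ Module.finrank ℝ E := by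
  borelize E
  let μ : Measure E := Measure.addHaar
  have hr : 0 < ε / 2 := by positivity
  have hR : 0 < 1 + ε / 2 := by positivity
  have hdisj : Set.Pairwise (s : Set E) (Function.onFun Disjoint fun c => ball c (ε / 2)) := by
    intro c hc c' hc' hcc'
    apply ball_disjoint_ball
    rw [dist_eq_norm]
    linarith [h c hc c' hc' hcc']
  have hsub : ⋃ c ∈ s, ball c (ε / 2) ⊆ ball (0 : E) (1 + ε / 2) := by
    refine Set.iUnion₂_subset fun c hc => ball_subset_ball' ?_
    rw [dist_zero_right]
    linarith [hs c hc]
  have hvol := measure_mono (μ := μ) hsub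
  rw [measure_biUnion_finset hdisj fun c _ => measurableSet_ball] at hvol
  simp only [μ.addHaar_ball_of_pos _ hr, μ.addHaar_ball_of_pos _ hR, Finset.sum_const,
    nsmul_eq_mul, ← mul_assoc] at hvol
  have hcard := (ENNReal.mul_le_mul_iff_left (measure_ball_pos μ _ zero_lt_one).ne'
    measure_ball_lt_top.ne).1 hvol
  have hreal := ENNReal.toReal_le_of_le_ofReal (by positivity) hcard
  rw [ENNReal.toReal_mul, ENNReal.toReal_natCast, ENNReal.toReal_ofReal (by positivity)] at hreal
  have hsplit : 1 + ε / 2 = (1 + 2 / ε) * (ε / 2) := by field_simp; ring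
  rw [hsplit, mul_pow] at hreal
  exact le_of_mul_le_mul_right hreal (by positivity)

/-- The unit sphere has an `ε`-net of cardinality at most `(1 + 2 / ε) ^ dim`. -/
theorem exists_net_unit_sphere (E : Type*) [NormedAddCommGroup E] [NormedSpace ℝ E]
    [FiniteDimensional ℝ E] {ε : ℝ} (hε : 0 < ε) :
    ∃ s : Finset E, (∀ c ∈ s, ‖c‖ = 1) ∧ (∀ x : E, ‖x‖ = 1 → ∃ c ∈ s, ‖x - c‖ < ε) ∧
      (s.card : ℝ) ≤ (1 + 2 / ε) ^ Module.finrank ℝ E := by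
  classical
  let S : Set ℕ := {n | ∃ s : Finset E, s.card = n ∧ (∀ c ∈ s, ‖c‖ = 1) ∧
    ∀ c ∈ s, ∀ c' ∈ s, c ≠ c' → ε ≤ ‖c - c'‖}
  have hne : S.Nonempty := ⟨0, ∅, by simp⟩
  have hbdd : BddAbove S := by
    refine ⟨⌊(1 + 2 / ε) ^ Module.finrank ℝ E⌋₊, ?_⟩
    rintro _ ⟨s, rfl, hs, hsep⟩
    exact Nat.le_floor (card_le_of_separated_unit_ball hε s (fun c hc => (hs c hc).le) hsep)
  obtain ⟨s, hcard, hs, hsep⟩ := Nat.sSup_mem hne hbdd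
  refine ⟨s, hs, fun x hx => ?_,
    card_le_of_separated_unit_ball hε s (fun c hc => (hs c hc).le) hsep⟩
  by_contra! hfar
  have hxs : x ∉ s := fun hxs => by
    have := hfar x hxs
    simp only [sub_self, norm_zero] at this
    linarith
  have hmem : (insert x s).card ∈ S := by
    refine ⟨_, rfl, ?_, ?_⟩
    · simpa [hx] using hs
    · intro c hc c' hc' hcc'
      rcases Finset.mem_insert.1 hc with rfl | hcs <;>
        rcases Finset.mem_insert.1 hc' with rfl | hcs'
      · exact absurd rfl hcc'
      · exact hfar c' hcs'
      · rw [norm_sub_rev]; exact hfar c hcs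
      · exact hsep c hcs c' hcs' hcc'
  have := le_csSup hbdd hmem
  rw [Finset.card_insert_of_notMem hxs, hcard] at this
  omega

/-- Transposing the index sets of an i.i.d. array preserves its law. -/
theorem map_swap_pi_pi {ι κ α : Type*} [Fintype ι] [Fintype κ] [MeasurableSpace α]
    (γ : Measure α) [IsProbabilityMeasure γ] :
    (Measure.pi fun _ : ι => Measure.pi fun _ : κ => γ).map Function.swap =
      Measure.pi fun _ : κ => Measure.pi fun _ : ι => γ := by
  have hswap : Measurable (Function.swap : (ι → κ → α) → κ → ι → α) := by
    unfold Function.swap; fun_prop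
  symm
  refine Measure.pi_eq_generateFrom (fun _ => generateFrom_pi) (fun _ => isPiSystem_pi)
    (fun _ => Measure.FiniteSpanningSetsIn.pi fun _ => γ.toFiniteSpanningSetsIn) ?_
  intro s hs
  choose t ht hts using hs
  simp only [Set.mem_pi, Set.mem_univ, forall_const, Set.mem_ofPred_eq] at ht
  obtain rfl : (fun k => Set.univ.pi (t k)) = s := funext hts
  rw [Measure.map_apply hswap
    (MeasurableSet.univ_pi fun k => MeasurableSet.univ_pi fun i => ht k i)]
  have hpre : Function.swap ⁻¹' (Set.univ.pi fun k => Set.univ.pi (t k)) =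
      Set.univ.pi fun i => Set.univ.pi fun k => t k i := by
    ext A
    simpa [Set.mem_pi, Function.swap] using forall_comm
  rw [hpre]
  simp only [Measure.pi_pi]
  exact Finset.prod_comm

/-- A unit linear combination of independent standard Gaussians is standard Gaussian. -/
theorem map_sum_mul_pi_gaussianReal {ι : Type*} [Fintype ι] (y : EuclideanSpace ℝ ι)
    (hy : ‖y‖ = 1) :
    (Measure.pi fun _ : ι => gaussianReal 0 1).map (fun a => ∑ i, a i * y i) =
      gaussianReal 0 1 := by
  have hcomp : (fun a : ι → ℝ => ∑ i, a i * y i) = innerSL ℝ y ∘ WithLp.toLp 2 := by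
    ext a
    simp [PiLp.inner_apply]
  rw [hcomp, ← Measure.map_map (by fun_prop) (by fun_prop), map_pi_eq_stdGaussian,
    IsGaussian.map_eq_gaussianReal, integral_strongDual_stdGaussian, variance_dual_stdGaussian]
  simp [hy]

/-- A unit linear combination of the rows of an i.i.d. standard Gaussian array is an i.i.d.
standard Gaussian vector. -/
theorem map_row_combination_pi_gaussianReal {ι κ : Type*} [Fintype ι] [Fintype κ]
    (y : EuclideanSpace ℝ ι) (hy : ‖y‖ = 1) :
    (Measure.pi fun _ : ι => Measure.pi fun _ : κ => gaussianReal 0 1).map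
      (fun A k => ∑ i, A i k * y i) = Measure.pi fun _ : κ => gaussianReal 0 1 := by
  have hcomp : (fun (A : ι → κ → ℝ) k => ∑ i, A i k * y i) =
      (fun (B : κ → ι → ℝ) k => ∑ i, B k i * y i) ∘ Function.swap := rfl
  have hswap : Measurable (Function.swap : (ι → κ → ℝ) → κ → ι → ℝ) := by
    unfold Function.swap; fun_prop
  have hmap := map_sum_mul_pi_gaussianReal y hy
  rw [hcomp, ← Measure.map_map (by fun_prop) hswap, map_swap_pi_pi]
  have : SigmaFinite ((Measure.pi fun _ : ι => gaussianReal 0 1).map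
      fun a => ∑ i, a i * y i) := by rw [hmap]; infer_instance
  rw [Measure.pi_map_pi (f := fun _ (a : ι → ℝ) => ∑ i, a i * y i)
    fun _ => Measurable.aemeasurable (by fun_prop), hmap]

/-- Markov's inequality for a product of functions of i.i.d. variables. -/
theorem mul_measure_pi_prod_ge_le {κ α : Type*} [Fintype κ] [MeasurableSpace α] (γ : Measure α)
    [IsProbabilityMeasure γ] {f : α → ℝ≥0∞} (hf : Measurable f) (t : ℝ≥0∞) :
    t * (Measure.pi fun _ : κ => γ) {z | t ≤ ∏ k, f (z k)} ≤
      (∫⁻ x, f x ∂γ) ^ Fintype.card κ := by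
  refine (mul_meas_ge_le_lintegral (by fun_prop) t).trans_eq ?_
  rw [lintegral_prod_eq_prod_lintegral_of_indepFun Finset.univ (fun k (z : κ → α) => f (z k))
    (iIndepFun_pi fun _ => hf.aemeasurable) fun k => by fun_prop]
  have heval (k : κ) : ∫⁻ z : κ → α, f (z k) ∂(Measure.pi fun _ => γ) = ∫⁻ x, f x ∂γ :=
    (measurePreserving_eval (fun _ => γ) k).lintegral_comp hf
  simp [heval]

/-- Small-ball estimate for the standard Gaussian. -/
theorem gaussianReal_abs_lt_le (a : ℝ) :
    gaussianReal 0 1 {z | |z| < a} ≤ ENNReal.ofReal (2 * a / √(2 * Real.pi)) := by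
  have hset : {z : ℝ | |z| < a} = Set.Ioo (-a) a := by ext; simp [abs_lt]
  rw [hset, gaussianReal_apply 0 one_ne_zero]
  calc ∫⁻ x in Set.Ioo (-a) a, gaussianPDF 0 1 x
      ≤ ∫⁻ _ in Set.Ioo (-a) a, ENNReal.ofReal (√(2 * Real.pi))⁻¹ := by
        refine lintegral_mono fun x => ENNReal.ofReal_le_ofReal ?_
        rw [gaussianPDFReal]
        simp only [NNReal.coe_one, mul_one, sub_zero]
        refine mul_le_of_le_one_right (by positivity) (Real.exp_le_one_iff.2 ?_)
        have := sq_nonneg x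
        linarith
    _ = ENNReal.ofReal (2 * a / √(2 * Real.pi)) := by
        rw [setLIntegral_const, Real.volume_Ioo, ← ENNReal.ofReal_mul (by positivity)]
        congr 1
        ring

theorem lintegral_exp_sq_div_four_gaussianReal :
    ∫⁻ z, ENNReal.ofReal (Real.exp (z ^ 2 / 4)) ∂gaussianReal 0 1 = ENNReal.ofReal √2 := by
  rw [gaussianReal_of_var_ne_zero 0 one_ne_zero,
    lintegral_withDensity_eq_lintegral_mul _ (measurable_gaussianPDF 0 1) (by fun_prop)]
  have hprod (z : ℝ) : (gaussianPDF 0 1 * fun z => ENNReal.ofReal (Real.exp (z ^ 2 / 4))) z =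
      ENNReal.ofReal ((√(2 * Real.pi))⁻¹ * Real.exp (-(1 / 4) * z ^ 2)) := by
    rw [Pi.mul_apply, gaussianPDF, ← ENNReal.ofReal_mul (gaussianPDFReal_nonneg 0 1 z),
      gaussianPDFReal, mul_assoc, ← Real.exp_add]
    simp only [NNReal.coe_one, mul_one, sub_zero]
    congr 3
    ring
  simp_rw [hprod]
  rw [← ofReal_integral_eq_lintegral_ofReal
    ((integrable_exp_neg_mul_sq (by norm_num)).const_mul _) (ae_of_all _ fun z => by positivity),
    integral_const_mul, integral_gaussian]
  congr 1
  rw [← Real.sqrt_inv, ← Real.sqrt_mul (by positivity)]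
  congr 1
  field_simp
  norm_num

/-- Chernoff bound for the number of small coordinates of a standard Gaussian vector. -/
theorem measure_pi_gaussianReal_card_ge_le {κ : Type*} [Fintype κ] {a q p : ℝ} (hq : 0 ≤ q)
    (haq : 2 * a / √(2 * Real.pi) ≤ q) :
    (Measure.pi fun _ : κ => gaussianReal 0 1)
      {z | p ≤ (Finset.univ.filter fun k => |z k| < a).card} ≤
      ENNReal.ofReal (Real.exp (Fintype.card κ * q - p * Real.log 2)) := by
  let f : ℝ → ℝ≥0∞ := fun z => if |z| < a then 2 else 1
  have hmeas : MeasurableSet {z : ℝ | |z| < a} := measurableSet_lt (by fun_prop) (by fun_prop)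
  have hf : Measurable f := Measurable.ite hmeas (by fun_prop) (by fun_prop)
  have hint : ∫⁻ z, f z ∂gaussianReal 0 1 ≤ ENNReal.ofReal (Real.exp q) := by
    have hsplit : f = fun z => 1 + {z : ℝ | |z| < a}.indicator 1 z := by
      ext z
      by_cases hz : |z| < a <;> simp [f, hz, Set.indicator, one_add_one_eq_two]
    rw [hsplit, lintegral_add_left (by fun_prop), lintegral_one, measure_univ,
      lintegral_indicator_one hmeas]
    calc _ ≤ 1 + ENNReal.ofReal q := by
          gcongr
          exact (gaussianReal_abs_lt_le a).trans (ENNReal.ofReal_le_ofReal haq)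
      _ = ENNReal.ofReal (q + 1) := by
          rw [ENNReal.ofReal_add hq zero_le_one, ENNReal.ofReal_one, add_comm]
      _ ≤ _ := ENNReal.ofReal_le_ofReal (Real.add_one_le_exp q)
  have hprod (z : κ → ℝ) : ∏ k, f (z k) =
      ENNReal.ofReal (Real.exp ((Finset.univ.filter fun k => |z k| < a).card * Real.log 2)) := by
    simp only [f, Finset.prod_ite, Finset.prod_const, one_pow, mul_one]
    rw [Real.exp_nat_mul, Real.exp_log two_pos, ENNReal.ofReal_pow two_pos.le]
    simp
  have hmarkov := mul_measure_pi_prod_ge_le (κ := κ) (gaussianReal 0 1) hf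
    (ENNReal.ofReal (Real.exp (p * Real.log 2)))
  have hsub : {z : κ → ℝ | p ≤ (Finset.univ.filter fun k => |z k| < a).card} ⊆
      {z | ENNReal.ofReal (Real.exp (p * Real.log 2)) ≤ ∏ k, f (z k)} := by
    intro z hz
    rw [Set.mem_ofPred_eq, hprod]
    refine ENNReal.ofReal_le_ofReal (Real.exp_le_exp.2 ?_)
    exact mul_le_mul_of_nonneg_right hz (Real.log_nonneg one_le_two)
  rw [Real.exp_sub, ENNReal.ofReal_div_of_pos (Real.exp_pos _),
    ENNReal.le_div_iff_mul_le (by simp [Real.exp_pos]) (by simp), mul_comm]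
  refine (mul_le_mul_right (measure_mono hsub) _).trans (hmarkov.trans ?_)
  rw [Real.exp_nat_mul, ENNReal.ofReal_pow (Real.exp_pos _).le]
  gcongr

/-- Chernoff bound for the squared norm of a standard Gaussian vector. -/
theorem measure_pi_gaussianReal_sum_sq_ge_le {κ : Type*} [Fintype κ] (p : ℝ) :
    (Measure.pi fun _ : κ => gaussianReal 0 1) {z | p ≤ ∑ k, z k ^ 2} ≤
      ENNReal.ofReal (Real.exp (Fintype.card κ * (Real.log 2 / 2) - p / 4)) := by
  have hmarkov := mul_measure_pi_prod_ge_le (κ := κ) (gaussianReal 0 1)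
    (f := fun z => ENNReal.ofReal (Real.exp (z ^ 2 / 4))) (by fun_prop)
    (ENNReal.ofReal (Real.exp (p / 4)))
  rw [lintegral_exp_sq_div_four_gaussianReal] at hmarkov
  have hsub : {z : κ → ℝ | p ≤ ∑ k, z k ^ 2} ⊆ {z | ENNReal.ofReal (Real.exp (p / 4)) ≤
      ∏ k, ENNReal.ofReal (Real.exp (z k ^ 2 / 4))} := by
    intro z hz
    rw [Set.mem_ofPred_eq, ← ENNReal.ofReal_prod_of_nonneg fun _ _ => (Real.exp_pos _).le,
      ← Real.exp_sum, ← Finset.sum_div]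
    refine ENNReal.ofReal_le_ofReal (Real.exp_le_exp.2 ?_)
    exact div_le_div_of_nonneg_right hz (by norm_num)
  rw [Real.exp_sub, ENNReal.ofReal_div_of_pos (Real.exp_pos _),
    ENNReal.le_div_iff_mul_le (by simp [Real.exp_pos]) (by simp), mul_comm]
  refine (mul_le_mul_right (measure_mono hsub) _).trans (hmarkov.trans_eq ?_)
  rw [Real.exp_nat_mul, ENNReal.ofReal_pow (Real.exp_pos _).le, ← Real.log_sqrt two_pos.le,
    Real.exp_log (by positivity)]

/-- The operator norm is controlled by the values on a `1 / 2`-net of the unit sphere. -/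
theorem opNorm_le_two_mul_of_net {E F : Type*} [NormedAddCommGroup E] [NormedSpace ℝ E]
    [NormedAddCommGroup F] [NormedSpace ℝ F] (T : E →L[ℝ] F) {s : Finset E} {M : ℝ} (hM : 0 ≤ M)
    (hnet : ∀ x : E, ‖x‖ = 1 → ∃ c ∈ s, ‖x - c‖ ≤ 1 / 2) (hs : ∀ c ∈ s, ‖T c‖ ≤ M) :
    ‖T‖ ≤ 2 * M := by
  have hT : ‖T‖ ≤ M + ‖T‖ / 2 := by
    refine ContinuousLinearMap.opNorm_le_of_unit_norm (by positivity) fun x hx => ?_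
    obtain ⟨c, hc, hxc⟩ := hnet x hx
    calc ‖T x‖ = ‖T c + T (x - c)‖ := by rw [← map_add, add_sub_cancel]
      _ ≤ ‖T c‖ + ‖T‖ * ‖x - c‖ := (norm_add_le _ _).trans (by gcongr; exact T.le_opNorm _)
      _ ≤ M + ‖T‖ * (1 / 2) := by gcongr; exact hs c hc
      _ = M + ‖T‖ / 2 := by ring
  linarith

/-- Few coordinates of a vector are large compared to its Euclidean norm. -/
theorem card_le_abs_mul_sq_le {κ : Type*} [Fintype κ] (z : EuclideanSpace ℝ κ) {r : ℝ}
    (hr : 0 ≤ r) : ((Finset.univ.filter fun k => r ≤ |z k|).card : ℝ) * r ^ 2 ≤ ‖z‖ ^ 2 := by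
  rw [EuclideanSpace.real_norm_sq_eq, ← nsmul_eq_mul]
  calc _ ≤ ∑ k ∈ Finset.univ.filter (fun k => r ≤ |z k|), z k ^ 2 := by
        refine Finset.card_nsmul_le_sum _ _ _ fun k hk => ?_
        rw [← sq_abs (z k)]
        exact pow_le_pow_left₀ hr (Finset.mem_filter.1 hk).2 2
    _ ≤ ∑ k, z k ^ 2 :=
        Finset.sum_le_sum_of_subset_of_nonneg (Finset.subset_univ _) fun _ _ _ => sq_nonneg _

/-- If `y` approximates `x`, then `T x` has not many more small coordinates than `T y`. -/
theorem card_abs_lt_le_add {E κ : Type*} [NormedAddCommGroup E] [NormedSpace ℝ E] [Fintype κ]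
    (T : E →L[ℝ] EuclideanSpace ℝ κ) {x y : E} {a b ε : ℝ} (hba : b < a) (hxy : ‖x - y‖ ≤ ε) :
    ((Finset.univ.filter fun k => |T x k| < b).card : ℝ) ≤
      (Finset.univ.filter fun k => |T y k| < a).card + (‖T‖ * ε) ^ 2 / (a - b) ^ 2 := by
  classical
  have hab : 0 < a - b := sub_pos.2 hba
  have hsub : (Finset.univ.filter fun k => |T x k| < b) ⊆
      (Finset.univ.filter fun k => |T y k| < a) ∪
        Finset.univ.filter fun k => a - b ≤ |T (x - y) k| := by
    intro k hk
    simp only [Finset.mem_filter, Finset.mem_union, Finset.mem_univ, true_and] at hk ⊢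
    by_contra! h
    have htri := abs_sub_abs_le_abs_sub (T y k) (T x k)
    rw [map_sub, PiLp.sub_apply, abs_sub_comm] at h
    linarith
  have hfar : ((Finset.univ.filter fun k => a - b ≤ |T (x - y) k|).card : ℝ) ≤
      (‖T‖ * ε) ^ 2 / (a - b) ^ 2 := by
    rw [le_div_iff₀ (by positivity)]
    refine (card_le_abs_mul_sq_le _ hab.le).trans ?_
    gcongr
    exact (T.le_opNorm _).trans (by gcongr)
  have hcard := (Finset.card_le_card hsub).trans (Finset.card_union_le _ _)
  have hcard' : ((Finset.univ.filter fun k => |T x k| < b).card : ℝ) ≤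
      (Finset.univ.filter fun k => |T y k| < a).card +
        (Finset.univ.filter fun k => a - b ≤ |T (x - y) k|).card := by exact_mod_cast hcard
  linarith

/-- The array `A` viewed as the operator sending `x` to the combination of its rows with
coefficients `x`. -/
noncomputable def rowCombination {ι κ : Type*} [Fintype ι] [Fintype κ] (A : ι → κ → ℝ) :
    EuclideanSpace ℝ ι →L[ℝ] EuclideanSpace ℝ κ :=
  LinearMap.toContinuousLinearMap
    { toFun := fun x => WithLp.toLp 2 fun k => ∑ i, A i k * x i
      map_add' := fun x y => by ext k; simp [mul_add, Finset.sum_add_distrib]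
      map_smul' := fun c x => by ext k; simp [Finset.mul_sum, mul_left_comm] }

theorem rowCombination_apply {ι κ : Type*} [Fintype ι] [Fintype κ] (A : ι → κ → ℝ)
    (x : EuclideanSpace ℝ ι) (k : κ) : rowCombination A x k = ∑ i, A i k * x i := rfl

/-- The set of arrays for which some unit vector of the finite set `s` has an image that is large
or has many small coordinates. -/
def badArrays {ι κ : Type*} [Fintype ι] [Fintype κ] (s : Finset (EuclideanSpace ℝ ι))
    (a p M : ℝ) : Set (ι → κ → ℝ) :=
  ⋃ y ∈ s, (fun A k => ∑ i, A i k * y i) ⁻¹'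
    ({z : κ → ℝ | p ≤ (Finset.univ.filter fun k => |z k| < a).card} ∪ {z | M ≤ ∑ k, z k ^ 2})

theorem measure_badArrays_le {ι κ : Type*} [Fintype ι] [Fintype κ]
    {s : Finset (EuclideanSpace ℝ ι)} (hs : ∀ y ∈ s, ‖y‖ = 1) {a q p M b : ℝ} (hq : 0 ≤ q)
    (haq : 2 * a / √(2 * Real.pi) ≤ q)
    (hp : Fintype.card κ * q - p * Real.log 2 ≤ -b)
    (hM : Fintype.card κ * (Real.log 2 / 2) - M / 4 ≤ -b) :
    (Measure.pi fun _ : ι => Measure.pi fun _ : κ => gaussianReal 0 1) (badArrays s a p M) ≤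
      ENNReal.ofReal (s.card * (2 * Real.exp (-b))) := by
  have hmeas : MeasurableSet ({z : κ → ℝ | p ≤ (Finset.univ.filter fun k => |z k| < a).card} ∪
      {z | M ≤ ∑ k, z k ^ 2}) := by
    refine MeasurableSet.union ?_ (measurableSet_le (by fun_prop) (by fun_prop))
    simp only [Finset.card_filter, Nat.cast_sum, Nat.cast_ite, Nat.cast_one, Nat.cast_zero]
    refine measurableSet_le measurable_const (Finset.measurable_sum _ fun k _ => ?_)
    exact Measurable.ite (measurableSet_lt (by fun_prop) (by fun_prop)) measurable_const
      measurable_const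
  refine (measure_biUnion_finset_le _ _).trans ?_
  rw [ENNReal.ofReal_mul (by positivity), ENNReal.ofReal_natCast, ← nsmul_eq_mul]
  refine Finset.sum_le_card_nsmul _ _ _ fun y hy => ?_
  rw [← Measure.map_apply (by fun_prop) hmeas, map_row_combination_pi_gaussianReal y (hs y hy),
    two_mul, ENNReal.ofReal_add (Real.exp_pos _).le (Real.exp_pos _).le]
  refine (measure_union_le _ _).trans (add_le_add ?_ ?_)
  · exact (measure_pi_gaussianReal_card_ge_le hq haq).trans
      (ENNReal.ofReal_le_ofReal (Real.exp_le_exp.2 hp))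
  · exact (measure_pi_gaussianReal_sum_sq_ge_le M).trans
      (ENNReal.ofReal_le_ofReal (Real.exp_le_exp.2 hM))

/-- Outside `badArrays s a p M`, every unit vector has an image with few small coordinates. -/
theorem card_abs_lt_of_notMem_badArrays {ι κ : Type*} [Fintype ι] [Fintype κ]
    {s : Finset (EuclideanSpace ℝ ι)} {a b p M ε : ℝ} (hba : b < a) (hM : 0 ≤ M) (hε : ε ≤ 1 / 2)
    (hnet : ∀ x : EuclideanSpace ℝ ι, ‖x‖ = 1 → ∃ c ∈ s, ‖x - c‖ < ε) {A : ι → κ → ℝ}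
    (hA : A ∉ badArrays s a p M) {x : EuclideanSpace ℝ ι} (hx : ‖x‖ = 1) :
    ((Finset.univ.filter fun k => |∑ i, A i k * x i| < b).card : ℝ) <
      p + 4 * M * ε ^ 2 / (a - b) ^ 2 := by
  simp only [badArrays, Set.mem_iUnion, Set.mem_preimage, Set.mem_union, Set.mem_ofPred_eq,
    not_exists, not_or, not_le] at hA
  have hnorm : ‖rowCombination A‖ ≤ 2 * √M := by
    refine opNorm_le_two_mul_of_net _ (Real.sqrt_nonneg M)
      (fun x hx => (hnet x hx).imp fun c hc => ⟨hc.1, hc.2.le.trans hε⟩) fun c hc => ?_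
    refine Real.le_sqrt_of_sq_le ?_
    rw [EuclideanSpace.real_norm_sq_eq]
    exact (hA c hc).2.le
  obtain ⟨c, hc, hxc⟩ := hnet x hx
  have hcount := card_abs_lt_le_add (rowCombination A) hba hxc.le
  have hε0 : 0 ≤ ε := (norm_nonneg _).trans hxc.le
  have hsq : (‖rowCombination A‖ * ε) ^ 2 / (a - b) ^ 2 ≤ 4 * M * ε ^ 2 / (a - b) ^ 2 := by
    gcongr
    calc (‖rowCombination A‖ * ε) ^ 2 ≤ (2 * √M * ε) ^ 2 := by gcongr
      _ = 4 * M * ε ^ 2 := by rw [mul_pow, mul_pow, Real.sq_sqrt hM]; ring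
  have hlt := (hA c hc).1
  simp only [rowCombination_apply] at hcount
  linarith

/-- The union bound over the net is beaten by the Chernoff exponent. -/
theorem net_union_bound {d D : ℕ} {l c : ℝ} (hd : 1 ≤ d) (hl : 0 < l) (hl1 : l ≤ 1)
    (hD : 2400 * d / l ^ 2 ≤ D) (hc : c ≤ (1 + 2 / (l ^ 2 / 320)) ^ d) :
    c * (2 * Real.exp (-(l * D / 4))) ≤ Real.exp (-(2 / 9) * l ^ 2 * D) := by
  have hd' : (1 : ℝ) ≤ d := by exact_mod_cast hd
  have hbase : 1 + 2 / (l ^ 2 / 320) ≤ Real.exp (62 / l) := by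
    have hexp : 31 / l ≤ Real.exp (31 / l) := by linarith [Real.add_one_le_exp (31 / l)]
    calc 1 + 2 / (l ^ 2 / 320) ≤ (31 / l) ^ 2 := by
          rw [div_pow, ← sub_nonneg]
          have : (31 : ℝ) ^ 2 / l ^ 2 - (1 + 2 / (l ^ 2 / 320)) = (321 - l ^ 2) / l ^ 2 := by
            field_simp; ring
          rw [this]
          exact div_nonneg (by nlinarith) (by positivity)
      _ ≤ Real.exp (31 / l) ^ 2 := by gcongr
      _ = Real.exp (62 / l) := by rw [← Real.exp_nat_mul]; congr 1; push_cast; ring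
  have htwo : 2 ≤ Real.exp (d / l) := by
    have hone : 1 ≤ d / l := by rw [le_div_iff₀ hl]; linarith
    linarith [Real.add_one_le_exp (d / l)]
  have hDl : 2400 * (d / l) ≤ l * D := by
    rw [div_le_iff₀ (by positivity)] at hD
    rw [← mul_div_assoc, div_le_iff₀ hl]
    linarith
  have hlD : 0 ≤ l * D := by positivity
  have hll : l ^ 2 * D ≤ l * D := by nlinarith
  calc c * (2 * Real.exp (-(l * D / 4)))
      ≤ Real.exp (62 / l) ^ d * (Real.exp (d / l) * Real.exp (-(l * D / 4))) := by
        gcongr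
        exact hc.trans (by gcongr)
    _ = Real.exp (63 * (d / l) - l * D / 4) := by
        rw [← Real.exp_nat_mul, ← Real.exp_add, ← Real.exp_add]
        congr 1
        ring
    _ ≤ _ := Real.exp_le_exp.2 (by linarith)

/-- There is an absolute constant `C > 0` such that whenever `λ = lD/D` with `lD ∈ [D]` and
`D ≥ C·d/λ²`, a `d × D` matrix with i.i.d. standard Gaussian entries has
`(λD, (√π/(3√2))·λ)`-projective uniformity with probability at least
`1 - exp(-(2/9)·λ²·D)`. -/
theorem stmt10 : ∃ C : ℝ, 0 < C ∧ ∀ (d D lD : ℕ), lD ∈ Finset.Icc 1 D →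
    (D : ℝ) ≥ C * d / ((lD : ℝ) / D) ^ 2 →
    (Measure.pi fun _ : Fin d => Measure.pi fun _ : Fin D => ProbabilityTheory.gaussianReal 0 1)
      {A : Fin d → Fin D → ℝ | ∀ x : Fin d → ℝ, ∑ i, x i ^ 2 = 1 →
        Set.ncard {k : Fin D | |∑ i, A i k * x i| <
          Real.sqrt Real.pi / (3 * Real.sqrt 2) * ((lD : ℝ) / D)} ≤ lD - 1} ≥
      ENNReal.ofReal (1 - Real.exp (-(2 / 9) * ((lD : ℝ) / D) ^ 2 * D)) := by
  refine ⟨2400, by norm_num, fun d D lD hlD hD => ?_⟩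
  obtain ⟨hlD1, hlD2⟩ := Finset.mem_Icc.1 hlD
  rcases Nat.eq_zero_or_pos d with rfl | hd
  · simp only [Finset.univ_eq_empty, Finset.sum_empty, zero_ne_one, false_imp_iff, forall_const,
      Set.ofPred_true, measure_univ]
    exact ENNReal.ofReal_le_one.2 (by linarith [Real.exp_pos (-(2 / 9) * ((lD : ℝ) / D) ^ 2 * D)])
  have hD0 : (0 : ℝ) < D := by exact_mod_cast (hlD1.trans hlD2)
  have hlD0 : (0 : ℝ) < lD := by exact_mod_cast hlD1
  set l : ℝ := lD / D with hl_def
  have hl : 0 < l := div_pos hlD0 hD0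
  have hl1 : l ≤ 1 := div_le_one_of_le₀ (by exact_mod_cast hlD2) hD0.le
  have hlmul : l * D = lD := div_mul_cancel₀ _ hD0.ne'
  set t : ℝ := √Real.pi / (3 * √2) with ht
  have ht0 : 0 < t := by positivity
  have ht_sq : t ^ 2 = Real.pi / 18 := by
    rw [ht, div_pow, mul_pow, Real.sq_sqrt Real.pi_pos.le, Real.sq_sqrt two_pos.le]; norm_num
  have ht_density : 2 * t / √(2 * Real.pi) = 1 / 3 := by
    rw [ht, Real.sqrt_mul two_pos.le]
    have := Real.sq_sqrt two_pos.le
    field_simp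
    linarith
  obtain ⟨s, hs, hnet, hcard⟩ := exists_net_unit_sphere (EuclideanSpace ℝ (Fin d))
    (ε := l ^ 2 / 320) (by positivity)
  rw [finrank_euclideanSpace_fin] at hcard
  have hbad : (Measure.pi fun _ : Fin d => Measure.pi fun _ : Fin D => gaussianReal 0 1)
      (badArrays s (11 / 10 * (t * l)) (9 / 10 * lD) (4 * D)) ≤
      ENNReal.ofReal (Real.exp (-(2 / 9) * l ^ 2 * D)) := by
    have hlog := Real.log_two_gt_d9
    have hlog' := Real.log_two_lt_d9
    refine (measure_badArrays_le hs (q := 11 / 30 * l) (b := l * D / 4) (by positivity) ?_ ?_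
      ?_).trans (ENNReal.ofReal_le_ofReal (net_union_bound hd hl hl1 hD hcard))
    · refine le_of_eq ?_
      calc 2 * (11 / 10 * (t * l)) / √(2 * Real.pi)
          = 11 / 10 * l * (2 * t / √(2 * Real.pi)) := by ring
        _ = 11 / 30 * l := by rw [ht_density]; ring
    · rw [Fintype.card_fin, ← hlmul]
      nlinarith [mul_pos hl hD0]
    · rw [Fintype.card_fin]
      nlinarith
  have hsub : (badArrays s (11 / 10 * (t * l)) (9 / 10 * lD) (4 * D))ᶜ ⊆
      {A : Fin d → Fin D → ℝ | ∀ x : Fin d → ℝ, ∑ i, x i ^ 2 = 1 →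
        Set.ncard {k : Fin D | |∑ i, A i k * x i| < t * l} ≤ lD - 1} := by
    intro A hA x hx
    have hx' : ‖WithLp.toLp 2 x‖ = 1 := by
      rw [EuclideanSpace.norm_eq]
      simp [hx]
    have hcount := card_abs_lt_of_notMem_badArrays (b := t * l)
      (by nlinarith [mul_pos ht0 hl]) (by positivity) (by nlinarith) hnet hA hx'
    have herr : 4 * (4 * D) * (l ^ 2 / 320) ^ 2 / (11 / 10 * (t * l) - t * l) ^ 2 ≤
        1 / 10 * (lD : ℝ) := by
      have hden : (11 / 10 * (t * l) - t * l) ^ 2 = Real.pi / 1800 * l ^ 2 := by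
        linear_combination (1 / 100 * l ^ 2) * ht_sq
      rw [hden, div_le_iff₀ (by positivity), ← hlmul]
      have hpow : l ^ 4 * D ≤ l ^ 3 * D := by
        gcongr ?_ * _
        exact pow_le_pow_of_le_one hl.le hl1 (by norm_num)
      have hpi : 3 * (l ^ 3 * D) ≤ Real.pi * (l ^ 3 * D) := by
        gcongr
        exact Real.pi_gt_three.le
      nlinarith
    have hlt : (Finset.univ.filter fun k : Fin D => |∑ i, A i k * x i| < t * l).card < lD := by
      have : ((Finset.univ.filter fun k : Fin D => |∑ i, A i k * x i| < t * l).card : ℝ) < lD :=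
        hcount.trans_le (by linarith)
      exact_mod_cast this
    rw [Set.ncard_eq_toFinset_card', Set.toFinset_ofPred]
    omega
  calc ENNReal.ofReal (1 - Real.exp (-(2 / 9) * l ^ 2 * D))
      = 1 - ENNReal.ofReal (Real.exp (-(2 / 9) * l ^ 2 * D)) := by
        rw [ENNReal.ofReal_sub _ (Real.exp_pos _).le, ENNReal.ofReal_one]
    _ ≤ 1 - (Measure.pi fun _ : Fin d => Measure.pi fun _ : Fin D => gaussianReal 0 1)
          (badArrays s (11 / 10 * (t * l)) (9 / 10 * lD) (4 * D)) := tsub_le_tsub_left hbad 1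
    _ ≤ _ := by
        refine tsub_le_iff_left.2 ?_
        rw [← measure_univ (μ := Measure.pi fun _ : Fin d =>
          Measure.pi fun _ : Fin D => gaussianReal 0 1), ← Set.union_compl_self]
        exact (measure_union_le _ _).trans (add_le_add le_rfl (measure_mono hsub))
end
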